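/- Every subgroup of finite index in π₁(𝒢₆) is isomorphic to exactly one of: ℤ³, π₁(𝒢₂) = ⟨x, y, z : xy = yx, zxz⁻¹ = x⁻¹, zyz⁻¹ = y⁻¹⟩, or π₁(𝒢₆) itself; the type is determined by the order (1, 2, or 4) of the image of the subgroup in π₁(𝒢₆)/⟨x²,y²,z²⟩ ≅ ℤ₂². -/

import Mathlib

/-- The relations of the Hantzsche–Wendt group:
`x y² x⁻¹ y² = 1`, `y x² y⁻¹ x² = 1`, `x y z = 1`, with `x, y, z` the generators `0, 1, 2`. -/
def hwRels : Set (FreeGroup (Fin 3)) :=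
  { FreeGroup.of 0 * FreeGroup.of 1 ^ 2 * (FreeGroup.of 0)⁻¹ * FreeGroup.of 1 ^ 2,
    FreeGroup.of 1 * FreeGroup.of 0 ^ 2 * (FreeGroup.of 1)⁻¹ * FreeGroup.of 0 ^ 2,
    FreeGroup.of 0 * FreeGroup.of 1 * FreeGroup.of 2 }

/-- The fundamental group of the Hantzsche–Wendt manifold `𝒢₆`. -/
abbrev HW : Type := PresentedGroup hwRels

def hwx : HW := PresentedGroup.of 0
def hwy : HW := PresentedGroup.of 1
def hwz : HW := PresentedGroup.of 2

/-- The relations of `π₁(𝒢₂)`: `x y x⁻¹ y⁻¹ = 1`, `z x z⁻¹ x = 1`, `z y z⁻¹ y = 1`. -/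
def g2Rels : Set (FreeGroup (Fin 3)) :=
  { FreeGroup.of 0 * FreeGroup.of 1 * (FreeGroup.of 0)⁻¹ * (FreeGroup.of 1)⁻¹,
    FreeGroup.of 2 * FreeGroup.of 0 * (FreeGroup.of 2)⁻¹ * FreeGroup.of 0,
    FreeGroup.of 2 * FreeGroup.of 1 * (FreeGroup.of 2)⁻¹ * FreeGroup.of 1 }

/-- The fundamental group of the platycosm `𝒢₂`. -/
abbrev G2 : Type := PresentedGroup g2Rels


/-- The sign `(-1) ^ n` as an integer. -/
def paritySign (n : ℤ) : ℤ := if Even n then 1 else -1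

lemma paritySign_even {n : ℤ} (h : Even n) : paritySign n = 1 := if_pos h

lemma paritySign_odd {n : ℤ} (h : Odd n) : paritySign n = -1 :=
  if_neg (Int.not_even_iff_odd.2 h)

lemma even_paritySign_mul (m n : ℤ) : Even (paritySign m * n) ↔ Even n := by
  unfold paritySign; split_ifs <;> simp

lemma paritySign_congr {m n : ℤ} (h : Even m ↔ Even n) : paritySign m = paritySign n := by
  simp only [paritySign, h]

lemma paritySign_add_mul (k m n : ℤ) :
    paritySign (k + paritySign m * n) = paritySign k * paritySign n := by
  rw [paritySign_congr (n := k + n) (by simp only [Int.even_add, even_paritySign_mul])]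
  by_cases h : Even k <;> by_cases h' : Even n <;> simp [paritySign, Int.even_add, h, h']

lemma paritySign_neg_mul (m n : ℤ) : paritySign (-(paritySign m * n)) = paritySign n :=
  paritySign_congr (by rw [even_neg, even_paritySign_mul])

/-- Integer triples with a twisted multiplication: the triple `(a, b, c)` is the isometry of `ℝ³`
with translation part `(a, b, c)` and linear part `diag((-1)^c, (-1)^a, (-1)^b)`. The
Hantzsche–Wendt group is the subgroup of triples with even sum. -/
@[ext]
structure TwistedTriple where
  a : ℤ
  b : ℤ
  c : ℤ

namespace TwistedTriple

instance : Mul TwistedTriple :=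
  ⟨fun g h => ⟨g.a + paritySign g.c * h.a, g.b + paritySign g.a * h.b,
    g.c + paritySign g.b * h.c⟩⟩

instance : One TwistedTriple := ⟨⟨0, 0, 0⟩⟩

instance : Inv TwistedTriple :=
  ⟨fun g => ⟨-(paritySign g.c * g.a), -(paritySign g.a * g.b), -(paritySign g.b * g.c)⟩⟩

@[simp] lemma mul_a (g h : TwistedTriple) : (g * h).a = g.a + paritySign g.c * h.a := rfl
@[simp] lemma mul_b (g h : TwistedTriple) : (g * h).b = g.b + paritySign g.a * h.b := rfl
@[simp] lemma mul_c (g h : TwistedTriple) : (g * h).c = g.c + paritySign g.b * h.c := rfl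
@[simp] lemma one_a : (1 : TwistedTriple).a = 0 := rfl
@[simp] lemma one_b : (1 : TwistedTriple).b = 0 := rfl
@[simp] lemma one_c : (1 : TwistedTriple).c = 0 := rfl
@[simp] lemma inv_a (g : TwistedTriple) : (g⁻¹).a = -(paritySign g.c * g.a) := rfl
@[simp] lemma inv_b (g : TwistedTriple) : (g⁻¹).b = -(paritySign g.a * g.b) := rfl
@[simp] lemma inv_c (g : TwistedTriple) : (g⁻¹).c = -(paritySign g.b * g.c) := rfl

instance : Group TwistedTriple := Group.ofLeftAxioms
  (fun g h k => by
    ext <;> simp only [mul_a, mul_b, mul_c, paritySign_add_mul] <;> ring)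
  (fun g => by
    have h0 : paritySign 0 = 1 := paritySign_even Even.zero
    ext <;> simp [h0])
  (fun g => by
    ext <;> simp [paritySign_neg_mul])

/-- The translation subgroup. -/
def translation : Multiplicative (ℤ × ℤ × ℤ) →* TwistedTriple where
  toFun v := ⟨2 * v.toAdd.1, 2 * v.toAdd.2.1, 2 * v.toAdd.2.2⟩
  map_one' := rfl
  map_mul' v w := by
    ext <;> simp [paritySign_even, mul_add]

lemma translation_ofAdd (p q r : ℤ) :
    translation (.ofAdd (p, q, r)) = ⟨2 * p, 2 * q, 2 * r⟩ := rfl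

lemma translation_injective : Function.Injective translation := by
  intro v w h
  rw [TwistedTriple.ext_iff] at h
  obtain ⟨h1, h2, h3⟩ := h
  simp only [translation, MonoidHom.coe_mk, OneHom.coe_mk] at h1 h2 h3
  refine Multiplicative.toAdd.injective (Prod.ext ?_ (Prod.ext ?_ ?_)) <;> omega

lemma translation_zpow (p q r n : ℤ) : (⟨2 * p, 2 * q, 2 * r⟩ : TwistedTriple) ^ n =
    ⟨2 * (n * p), 2 * (n * q), 2 * (n * r)⟩ := by
  rw [← translation_ofAdd, ← map_zpow, ← ofAdd_zsmul]
  rfl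

/-- The parities of the first two coordinates; on triples with even sum this is the linear part. -/
def parity : TwistedTriple →* Multiplicative (ZMod 2 × ZMod 2) where
  toFun g := .ofAdd ((g.a : ZMod 2), (g.b : ZMod 2))
  map_one' := by simp
  map_mul' g h := by
    have key : ∀ m n : ℤ, ((paritySign m * n : ℤ) : ZMod 2) = n := fun m n => by
      unfold paritySign; split_ifs <;> simp
    simp only [mul_a, mul_b, Int.cast_add, key]
    rfl

/-- The cyclic permutation of the coordinates. -/
def rotate : TwistedTriple ≃* TwistedTriple where
  toFun g := ⟨g.b, g.c, g.a⟩
  invFun g := ⟨g.c, g.a, g.b⟩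
  left_inv _ := rfl
  right_inv _ := rfl
  map_mul' _ _ := rfl

lemma sq_of_odd_a_b {g : TwistedTriple} (ha : Odd g.a) (hb : Odd g.b) (hc : Even g.c) :
    g ^ (2 : ℤ) = ⟨2 * g.a, 2 * 0, 2 * 0⟩ := by
  rw [zpow_two]
  ext <;> simp [paritySign_even hc, paritySign_odd ha, paritySign_odd hb, two_mul]

lemma zpow_a_of_even_c {g : TwistedTriple} (hc : Even g.c) (n : ℤ) :
    (g ^ n).a = n * g.a ∧ Even (g ^ n).c := by
  induction n with
  | zero => simp
  | succ n ih =>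
    rw [zpow_add_one]
    refine ⟨?_, ?_⟩
    · simp only [mul_a, ih.1, paritySign_even ih.2]; ring
    · simp only [mul_c, Int.even_add, even_paritySign_mul, hc, ih.2]
  | pred n ih =>
    rw [zpow_sub_one]
    refine ⟨?_, ?_⟩
    · simp only [mul_a, inv_a, ih.1, paritySign_even ih.2, paritySign_even hc]; ring
    · simp only [mul_c, inv_c, Int.even_add, even_neg, even_paritySign_mul, hc, ih.2]

end TwistedTriple
lemma nonempty_linearEquiv_of_smul_mem {V : Type*} [AddCommGroup V] [Module.Free ℤ V]
    [Module.Finite ℤ V] (L : Submodule ℤ V) {m : ℤ} (hm : m ≠ 0) (h : ∀ v, m • v ∈ L) :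
    Nonempty (V ≃ₗ[ℤ] L) := by
  refine ⟨LinearEquiv.ofFinrankEq V L ?_⟩
  refine le_antisymm ?_ L.finrank_le
  exact LinearMap.finrank_le_finrank_of_injective
    (f := (LinearMap.lsmul ℤ V m).codRestrict L h)
    fun v w hvw =>
      smul_right_injective V hm (Subtype.ext_iff.1 hvw)

lemma exists_eq_zpow_mul_of_mem_closure {G : Type*} [Group G] {x y : G}
    (hx : x * y ^ 2 * x⁻¹ * y ^ 2 = 1) (hy : y * x ^ 2 * y⁻¹ * x ^ 2 = 1) {g : G}
    (hg : g ∈ Subgroup.closure {x, y}) :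
    ∃ i j k : ℤ, g = x ^ i * y ^ j * ((x * y) ^ (2 : ℤ)) ^ k := by
  set C : G := (x * y) ^ (2 : ℤ) with hC
  rw [zpow_two] at hC
  have hB : SemiconjBy x (y ^ (2 : ℤ)) (y ^ (2 : ℤ))⁻¹ := by
    rw [SemiconjBy, ← mul_inv_eq_iff_eq_mul]
    exact_mod_cast eq_inv_of_mul_eq_one_left hx
  have hA : SemiconjBy y (x ^ (2 : ℤ)) (x ^ (2 : ℤ))⁻¹ := by
    rw [SemiconjBy, ← mul_inv_eq_iff_eq_mul]
    exact_mod_cast eq_inv_of_mul_eq_one_left hy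
  have hA' : y * (x * x) = (x * x)⁻¹ * y := by simpa only [zpow_two] using hA.eq
  have hB' : y * y * x = x * (y * y)⁻¹ := by
    have := hB.inv_right.eq
    rw [inv_inv, zpow_two] at this
    exact this.symm
  have hCx : SemiconjBy x C C⁻¹ := by
    rw [SemiconjBy, eq_inv_mul_iff_mul_eq, hC]
    calc x * y * (x * y) * (x * (x * y * (x * y)))
        = x * y * x * (y * (x * x)) * y * x * y := by group
      _ = x * y * x⁻¹ * (y * y * x) * y := by rw [hA']; group
      _ = x := by rw [hB']; group
  have hCy : SemiconjBy y C C⁻¹ := by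
    rw [SemiconjBy, eq_inv_mul_iff_mul_eq, hC]
    calc x * y * (x * y) * (y * (x * y * (x * y)))
        = x * y * x * (y * y * x) * y * x * y := by group
      _ = x * (y * (x * x)) * y⁻¹ * x * y := by rw [hB']; group
      _ = y := by rw [hA']; group
  have hyx : y * x = x⁻¹ * y⁻¹ * C⁻¹ := by
    rw [eq_mul_inv_iff_mul_eq, hC]
    calc y * x * (x * y * (x * y)) = y * (x * x) * y * x * y := by group
      _ = (x * x)⁻¹ * (y * y * x) * y := by rw [hA']; group
      _ = x⁻¹ * y⁻¹ := by rw [hB']; group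
  have hyx' : y * x⁻¹ = x⁻¹⁻¹ * y⁻¹ * C⁻¹ := by
    rw [eq_mul_inv_iff_mul_eq, hC]
    calc y * x⁻¹ * (x * y * (x * y)) = y * y * x * y := by group
      _ = x⁻¹⁻¹ * y⁻¹ := by rw [hB']; group
  have mul_zpow_x : ∀ e : ℤ, SemiconjBy (x ^ e) (y ^ (2 : ℤ)) (y ^ (2 : ℤ))⁻¹ →
      y * x ^ e = (x ^ e)⁻¹ * y⁻¹ * C⁻¹ → SemiconjBy (x ^ e) C C⁻¹ → ∀ i j k : ℤ,
        ∃ i' j' k' : ℤ, x ^ i * y ^ j * C ^ k * x ^ e = x ^ i' * y ^ j' * C ^ k' := by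
    intro e h1 h2 h3 i j k
    have h3' : C ^ k * x ^ e = x ^ e * C ^ (-k) := by
      simpa using (h3.zpow_right (-k)).eq.symm
    have h1' : ∀ m : ℤ, y ^ (2 * m) * x ^ e = x ^ e * y ^ (2 * -m) := fun m => by
      have := (h1.zpow_right (-m)).eq
      rw [zpow_mul, zpow_mul]
      simpa using this.symm
    have h1'' : ∀ m : ℤ, y ^ (2 * m) * (x ^ e)⁻¹ = (x ^ e)⁻¹ * y ^ (2 * -m) := fun m => by
      rw [mul_inv_eq_iff_eq_mul, mul_assoc, h1', neg_neg, inv_mul_cancel_left]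
    rw [mul_assoc, h3']
    obtain ⟨m, rfl | rfl⟩ := j.even_or_odd'
    · refine ⟨i + e, 2 * -m, -k, ?_⟩
      rw [mul_assoc, ← mul_assoc (y ^ _), h1' m, zpow_add]
      simp only [mul_assoc]
    · refine ⟨i - e, 2 * -m - 1, -1 - k, ?_⟩
      rw [mul_assoc, ← mul_assoc (y ^ _), zpow_add_one, mul_assoc (y ^ _), h2, zpow_sub,
        zpow_sub_one, zpow_sub, ← mul_assoc (y ^ _), ← mul_assoc (y ^ _), h1'']
      simp only [mul_assoc, zpow_neg, zpow_one]
  have mul_zpow_y : ∀ e : ℤ, SemiconjBy (y ^ e) C C⁻¹ → ∀ i j k : ℤ,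
        ∃ i' j' k' : ℤ, x ^ i * y ^ j * C ^ k * y ^ e = x ^ i' * y ^ j' * C ^ k' := by
    intro e h3 i j k
    have h3' : C ^ k * y ^ e = y ^ e * C ^ (-k) := by
      simpa using (h3.zpow_right (-k)).eq.symm
    exact ⟨i, j + e, -k, by rw [mul_assoc, h3', zpow_add]; simp only [mul_assoc]⟩
  have inv_semiconj : ∀ u v : G, SemiconjBy u v v⁻¹ → SemiconjBy u⁻¹ v v⁻¹ := fun u v h => by
    simpa using h.inv_right.inv_symm_left
  induction hg using Subgroup.closure_induction_right with
  | one => exact ⟨0, 0, 0, by simp⟩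
  | mul_right g _ u hu ih =>
    obtain ⟨i, j, k, rfl⟩ := ih
    obtain rfl | rfl := hu
    · simpa using mul_zpow_x 1 (by simpa using hB) (by simpa using hyx) (by simpa using hCx) i j k
    · simpa using mul_zpow_y 1 (by simpa using hCy) i j k
  | mul_inv_cancel g _ u hu ih =>
    obtain ⟨i, j, k, rfl⟩ := ih
    obtain rfl | rfl := hu
    · simpa using mul_zpow_x (-1) (by simpa using inv_semiconj _ _ hB) (by simpa using hyx')
        (by simpa using inv_semiconj _ _ hCx) i j k
    · simpa using mul_zpow_y (-1) (by simpa using inv_semiconj _ _ hCy) i j k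

lemma hwx_mul_hwy_sq : hwx * hwy ^ 2 * hwx⁻¹ * hwy ^ 2 = 1 :=
  PresentedGroup.one_of_mem (rels := hwRels) (by simp [hwRels])

lemma hwy_mul_hwx_sq : hwy * hwx ^ 2 * hwy⁻¹ * hwx ^ 2 = 1 :=
  PresentedGroup.one_of_mem (rels := hwRels) (by simp [hwRels])

lemma hwz_eq : hwz = (hwx * hwy)⁻¹ :=
  eq_inv_of_mul_eq_one_right (PresentedGroup.one_of_mem (rels := hwRels) (by simp [hwRels]))

lemma closure_hwx_hwy : Subgroup.closure {hwx, hwy} = ⊤ := by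
  rw [eq_top_iff, ← PresentedGroup.closure_range_of, Subgroup.closure_le]
  have hx : hwx ∈ Subgroup.closure {hwx, hwy} := Subgroup.subset_closure (by simp)
  have hy : hwy ∈ Subgroup.closure {hwx, hwy} := Subgroup.subset_closure (by simp)
  rintro _ ⟨n, rfl⟩
  fin_cases n
  · exact hx
  · exact hy
  · change hwz ∈ _
    rw [hwz_eq]
    exact inv_mem (mul_mem hx hy)

lemma exists_eq_hw (g : HW) :
    ∃ i j k : ℤ, g = hwx ^ i * hwy ^ j * ((hwx * hwy) ^ (2 : ℤ) : HW) ^ k :=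
  exists_eq_zpow_mul_of_mem_closure hwx_mul_hwy_sq hwy_mul_hwx_sq
    (closure_hwx_hwy ▸ Subgroup.mem_top g)

/-- The homomorphism out of the Hantzsche–Wendt group given by two elements satisfying the first
two relations. -/
def hwLift {G : Type*} [Group G] (x y : G) (hx : x * y ^ 2 * x⁻¹ * y ^ 2 = 1)
    (hy : y * x ^ 2 * y⁻¹ * x ^ 2 = 1) : HW →* G :=
  PresentedGroup.toGroup (f := ![x, y, (x * y)⁻¹]) (by
    rintro r (rfl | rfl | rfl)
    · simpa using hx
    · simpa using hy
    · simp)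

@[simp] lemma hwLift_hwx {G : Type*} [Group G] {x y : G} (hx : x * y ^ 2 * x⁻¹ * y ^ 2 = 1)
    (hy : y * x ^ 2 * y⁻¹ * x ^ 2 = 1) : hwLift x y hx hy hwx = x :=
  PresentedGroup.toGroup.of _

@[simp] lemma hwLift_hwy {G : Type*} [Group G] {x y : G} (hx : x * y ^ 2 * x⁻¹ * y ^ 2 = 1)
    (hy : y * x ^ 2 * y⁻¹ * x ^ 2 = 1) : hwLift x y hx hy hwy = y :=
  PresentedGroup.toGroup.of _

lemma exists_eq_zpow_mul_zpow_mul_zpow_of_mem_closure {G : Type*} [Group G] {x y z : G}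
    (hxy : x * y = y * x) (hx : z * x * z⁻¹ * x = 1) (hy : z * y * z⁻¹ * y = 1)
    {g : G} (hg : g ∈ Subgroup.closure {x, y, z}) : ∃ i j k : ℤ, g = x ^ i * y ^ j * z ^ k := by
  have hzx : SemiconjBy z x x⁻¹ := by
    rw [SemiconjBy, ← mul_inv_eq_iff_eq_mul]
    exact eq_inv_of_mul_eq_one_left hx
  have hzy : SemiconjBy z y y⁻¹ := by
    rw [SemiconjBy, ← mul_inv_eq_iff_eq_mul]
    exact eq_inv_of_mul_eq_one_left hy
  have hyx (i j : ℤ) : y ^ j * x ^ i = x ^ i * y ^ j := ((Commute.zpow_zpow hxy i j).eq).symm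
  have inv_semiconj : ∀ u v : G, SemiconjBy u v v⁻¹ → SemiconjBy u⁻¹ v v⁻¹ := fun u v h => by
    simpa using h.inv_right.inv_symm_left
  have move : ∀ u v : G, SemiconjBy u v v⁻¹ → ∀ i : ℤ, u * v ^ i = v ^ (-i) * u :=
    fun u v h i => by simpa using (h.zpow_right i).eq
  have hz : ∀ u : G, SemiconjBy u x x⁻¹ → SemiconjBy u y y⁻¹ → ∀ i j k : ℤ,
      u * (x ^ i * y ^ j * z ^ k) = x ^ (-i) * y ^ (-j) * (u * z ^ k) := by
    intro u h1 h2 i j k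
    rw [← mul_assoc, ← mul_assoc, move u x h1, mul_assoc (x ^ _), move u y h2]
    simp only [mul_assoc]
  induction hg using Subgroup.closure_induction_left with
  | one => exact ⟨0, 0, 0, by simp⟩
  | mul_left u hu g _ ih =>
    obtain ⟨i, j, k, rfl⟩ := ih
    obtain rfl | rfl | rfl := hu
    · exact ⟨i + 1, j, k, by rw [add_comm, zpow_one_add]; simp only [mul_assoc]⟩
    · refine ⟨i, j + 1, k, ?_⟩
      rw [add_comm, zpow_one_add, ← mul_assoc, ← mul_assoc, ← mul_assoc]
      congr 2
      simpa using hyx i 1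
    · exact ⟨-i, -j, 1 + k, by rw [hz _ hzx hzy, zpow_one_add]⟩
  | inv_mul_cancel u hu g _ ih =>
    obtain ⟨i, j, k, rfl⟩ := ih
    obtain rfl | rfl | rfl := hu
    · exact ⟨-1 + i, j, k, by rw [zpow_add, zpow_neg_one]; simp only [mul_assoc]⟩
    · refine ⟨i, -1 + j, k, ?_⟩
      rw [zpow_add, ← mul_assoc, ← mul_assoc, ← mul_assoc]
      congr 2
      simpa using hyx i (-1)
    · exact ⟨-i, -j, -1 + k, by
        rw [hz _ (inv_semiconj _ _ hzx) (inv_semiconj _ _ hzy), zpow_add, zpow_neg_one]⟩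

lemma exists_eq_g2 (g : G2) : ∃ i j k : ℤ, g = PresentedGroup.of (rels := g2Rels) 0 ^ i *
    PresentedGroup.of 1 ^ j * PresentedGroup.of 2 ^ k := by
  refine exists_eq_zpow_mul_zpow_mul_zpow_of_mem_closure ?_ ?_ ?_ (Subgroup.closure_mono ?_
    ((PresentedGroup.closure_range_of g2Rels).symm ▸ Subgroup.mem_top g))
  · rw [← mul_inv_eq_iff_eq_mul, ← mul_inv_eq_one]
    exact PresentedGroup.one_of_mem (rels := g2Rels) (by simp [g2Rels])
  · exact PresentedGroup.one_of_mem (rels := g2Rels) (by simp [g2Rels])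
  · exact PresentedGroup.one_of_mem (rels := g2Rels) (by simp [g2Rels])
  · rintro _ ⟨n, rfl⟩
    fin_cases n <;> simp

/-- The homomorphism out of `G2` given by three elements satisfying the relations. -/
def g2Lift {G : Type*} [Group G] (x y z : G) (hxy : x * y * x⁻¹ * y⁻¹ = 1)
    (hx : z * x * z⁻¹ * x = 1) (hy : z * y * z⁻¹ * y = 1) : G2 →* G :=
  PresentedGroup.toGroup (f := ![x, y, z]) (by
    rintro r (rfl | rfl | rfl)
    · simpa using hxy
    · simpa using hx
    · simpa using hy)

lemma g2Lift_of {G : Type*} [Group G] {x y z : G} (hxy : x * y * x⁻¹ * y⁻¹ = 1)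
    (hx : z * x * z⁻¹ * x = 1) (hy : z * y * z⁻¹ * y = 1) (n : Fin 3) :
    g2Lift x y z hxy hx hy (PresentedGroup.of n) = ![x, y, z] n :=
  PresentedGroup.toGroup.of _

namespace TwistedTriple

lemma parity_eq_one_iff {g : TwistedTriple} : parity g = 1 ↔ Even g.a ∧ Even g.b := by
  rw [← ZMod.intCast_eq_zero_iff_even, ← ZMod.intCast_eq_zero_iff_even]
  exact Prod.ext_iff

/-- The subgroup of triples with even sum. -/
def evenSum : Subgroup TwistedTriple where
  carrier := {g | Even (g.a + g.b + g.c)}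
  one_mem' := by simp
  mul_mem' {g h} hg hh := by
    simp only [Set.mem_ofPred_eq, mul_a, mul_b, mul_c, Int.even_add, even_paritySign_mul] at *
    tauto
  inv_mem' {g} hg := by
    simp only [Set.mem_ofPred_eq, inv_a, inv_b, inv_c, Int.even_add, even_neg,
      even_paritySign_mul] at *
    exact hg

lemma mem_evenSum {g : TwistedTriple} : g ∈ evenSum ↔ Even (g.a + g.b + g.c) := Iff.rfl

lemma sq_of_odd_b_c {g : TwistedTriple} (ha : Even g.a) (hb : Odd g.b) (hc : Odd g.c) :
    g ^ (2 : ℤ) = ⟨2 * 0, 2 * g.b, 2 * 0⟩ := by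
  rw [zpow_two]
  ext <;> simp [paritySign_even ha, paritySign_odd hb, paritySign_odd hc, two_mul]

lemma sq_of_odd_a_c {g : TwistedTriple} (ha : Odd g.a) (hb : Even g.b) (hc : Odd g.c) :
    g ^ (2 : ℤ) = ⟨2 * 0, 2 * 0, 2 * g.c⟩ := by
  rw [zpow_two]
  ext <;> simp [paritySign_even hb, paritySign_odd ha, paritySign_odd hc, two_mul]

/-- A pair of triples with the parities of the images of `hwx` and `hwy`. -/
structure IsHWPair (x y : TwistedTriple) : Prop where
  x_a : Odd x.a
  x_b : Odd x.b
  x_c : Even x.c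
  y_a : Even y.a
  y_b : Odd y.b
  y_c : Odd y.c

namespace IsHWPair

variable {x y : TwistedTriple}

lemma mul_a_odd (h : IsHWPair x y) : Odd (x * y).a := by
  rw [mul_a, paritySign_even h.x_c, one_mul]
  exact h.x_a.add_even h.y_a

lemma mul_b_even (h : IsHWPair x y) : Even (x * y).b := by
  rw [mul_b, Int.even_add, even_paritySign_mul, ← Int.even_add]
  exact h.x_b.add_odd h.y_b

lemma mul_c_odd (h : IsHWPair x y) : Odd (x * y).c := by
  rw [mul_c, paritySign_odd h.x_b, neg_one_mul]
  exact h.x_c.add_odd h.y_c.neg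

lemma sq_x (h : IsHWPair x y) : x ^ (2 : ℤ) = ⟨2 * x.a, 2 * 0, 2 * 0⟩ :=
  sq_of_odd_a_b h.x_a h.x_b h.x_c

lemma sq_y (h : IsHWPair x y) : y ^ (2 : ℤ) = ⟨2 * 0, 2 * y.b, 2 * 0⟩ :=
  sq_of_odd_b_c h.y_a h.y_b h.y_c

lemma sq_mul (h : IsHWPair x y) : (x * y) ^ (2 : ℤ) = ⟨2 * 0, 2 * 0, 2 * (x * y).c⟩ :=
  sq_of_odd_a_c h.mul_a_odd h.mul_b_even h.mul_c_odd

lemma zpow_mul_zpow_mul_zpow (h : IsHWPair x y) (i j k : ℤ) :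
    (x ^ (2 : ℤ)) ^ i * (y ^ (2 : ℤ)) ^ j * ((x * y) ^ (2 : ℤ)) ^ k =
      ⟨2 * (i * x.a), 2 * (j * y.b), 2 * (k * (x * y).c)⟩ := by
  rw [h.sq_x, h.sq_y, h.sq_mul, translation_zpow, translation_zpow, translation_zpow]
  ext <;> simp [paritySign_even]

lemma rel_x (h : IsHWPair x y) : x * y ^ 2 * x⁻¹ * y ^ 2 = 1 := by
  have hy : y ^ 2 = ⟨2 * 0, 2 * y.b, 2 * 0⟩ := by exact_mod_cast h.sq_y
  rw [hy]
  have hs := paritySign_odd (h.x_b.add_even (even_two_mul y.b).neg)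
  ext <;> simp [paritySign_even, paritySign_odd, h.x_a, h.x_b, h.x_c, hs]

lemma rel_y (h : IsHWPair x y) : y * x ^ 2 * y⁻¹ * x ^ 2 = 1 := by
  have hx : x ^ 2 = ⟨2 * x.a, 2 * 0, 2 * 0⟩ := by exact_mod_cast h.sq_x
  rw [hx]
  have hs := paritySign_even (h.y_a.add (even_two_mul x.a).neg)
  ext <;> simp [paritySign_even, paritySign_odd, h.y_a, h.y_b, h.y_c, hs]

lemma even_of_parity_eq_one (h : IsHWPair x y) {i j k : ℤ}
    (hp : parity (x ^ i * y ^ j * ((x * y) ^ (2 : ℤ)) ^ k) = 1) : Even i ∧ Even j := by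
  have hx : parity x = .ofAdd (1, 1) := by
    refine Prod.ext ?_ ?_
    · exact ZMod.intCast_eq_one_iff_odd.2 h.x_a
    · exact ZMod.intCast_eq_one_iff_odd.2 h.x_b
  have hy : parity y = .ofAdd (0, 1) := by
    refine Prod.ext ?_ ?_
    · exact ZMod.intCast_eq_zero_iff_even.2 h.y_a
    · exact ZMod.intCast_eq_one_iff_odd.2 h.y_b
  have hz : parity ((x * y) ^ (2 : ℤ)) = 1 := by
    rw [parity_eq_one_iff, h.sq_mul]; simp
  rw [map_mul, map_zpow, hz, one_zpow, mul_one, map_mul, map_zpow, map_zpow, hx, hy,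
    ← ofAdd_zsmul, ← ofAdd_zsmul, ← ofAdd_add, ofAdd_eq_one, Prod.ext_iff] at hp
  obtain ⟨h1, h2⟩ := hp
  simp only [Prod.smul_mk, Prod.mk_add_mk, zsmul_eq_mul, mul_one, mul_zero, add_zero,
    Prod.fst_zero, Prod.snd_zero] at h1 h2
  rw [h1, zero_add] at h2
  exact ⟨ZMod.intCast_eq_zero_iff_even.1 h1, ZMod.intCast_eq_zero_iff_even.1 h2⟩

/-- The homomorphism from the Hantzsche–Wendt group given by a pair of suitable triples. -/
def hom (h : IsHWPair x y) : HW →* TwistedTriple := hwLift x y h.rel_x h.rel_y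

@[simp] lemma hom_hwx (h : IsHWPair x y) : h.hom hwx = x := hwLift_hwx _ _

@[simp] lemma hom_hwy (h : IsHWPair x y) : h.hom hwy = y := hwLift_hwy _ _

lemma hom_injective (h : IsHWPair x y) : Function.Injective h.hom := by
  rw [injective_iff_map_eq_one]
  intro g hg
  obtain ⟨i, j, k, rfl⟩ := exists_eq_hw g
  simp only [map_mul, map_zpow, hom_hwx, hom_hwy] at hg
  obtain ⟨hi, hj⟩ := h.even_of_parity_eq_one (hg ▸ map_one parity)
  obtain ⟨i, rfl⟩ := even_iff_two_dvd.1 hi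
  obtain ⟨j, rfl⟩ := even_iff_two_dvd.1 hj
  rw [zpow_mul, zpow_mul, h.zpow_mul_zpow_mul_zpow, TwistedTriple.ext_iff] at hg
  have hx : x.a ≠ 0 := fun h0 => by simpa [h0] using h.x_a
  have hy : y.b ≠ 0 := fun h0 => by simpa [h0] using h.y_b
  have hz : (x * y).c ≠ 0 := fun h0 => by simpa [h0] using h.mul_c_odd
  simp only [one_a, one_b, one_c, mul_eq_zero, OfNat.ofNat_ne_zero, false_or, hx, hy, hz,
    or_false] at hg
  obtain ⟨rfl, rfl, rfl⟩ := hg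
  simp

lemma mk_mem_range_hom (h : IsHWPair x y) (i j k : ℤ) :
    ⟨2 * (i * x.a), 2 * (j * y.b), 2 * (k * (x * y).c)⟩ ∈ h.hom.range :=
  ⟨(hwx ^ (2 : ℤ)) ^ i * (hwy ^ (2 : ℤ)) ^ j * ((hwx * hwy) ^ (2 : ℤ) : HW) ^ k, by
    simp only [map_mul, map_zpow, hom_hwx, hom_hwy, h.zpow_mul_zpow_mul_zpow]⟩

lemma range_hom_le (h : IsHWPair x y) {H : Subgroup TwistedTriple} (hx : x ∈ H) (hy : y ∈ H) :
    h.hom.range ≤ H := by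
  rw [MonoidHom.range_eq_map, ← closure_hwx_hwy, MonoidHom.map_closure, Subgroup.closure_le]
  rintro _ ⟨_, rfl | rfl, rfl⟩
  · simpa using hx
  · simpa using hy

end IsHWPair
end TwistedTriple

namespace TwistedTriple

lemma exists_dvd_a (H : Subgroup TwistedTriple) (hH : ∃ h ∈ H, Odd h.a ∧ Even h.c) :
    ∃ x ∈ H, Odd x.a ∧ Even x.c ∧ ∀ h ∈ H, Even h.c → x.a ∣ h.a := by
  let D : AddSubgroup ℤ :=
    { carrier := {n | ∃ h ∈ H, Even h.c ∧ h.a = n}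
      zero_mem' := ⟨1, H.one_mem, by simp, rfl⟩
      add_mem' := by
        rintro _ _ ⟨g, hg, hgc, rfl⟩ ⟨h, hh, hhc, rfl⟩
        refine ⟨g * h, H.mul_mem hg hh, ?_, by simp [paritySign_even hgc]⟩
        simp only [mul_c, Int.even_add, even_paritySign_mul, hgc, hhc]
      neg_mem' := by
        rintro _ ⟨g, hg, hgc, rfl⟩
        refine ⟨g⁻¹, H.inv_mem hg, ?_, by simp [paritySign_even hgc]⟩
        simp only [inv_c, even_neg, even_paritySign_mul, hgc] }
  obtain ⟨d, hd⟩ := Int.subgroup_cyclic D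
  have hdvd : ∀ h ∈ H, Even h.c → d ∣ h.a := fun h hh hc => by
    have : h.a ∈ D := ⟨h, hh, hc, rfl⟩
    rw [hd, AddSubgroup.mem_closure_singleton] at this
    obtain ⟨n, hn⟩ := this
    exact ⟨n, by rw [← hn, smul_eq_mul, mul_comm]⟩
  have hmem : d ∈ D := hd ▸ AddSubgroup.subset_closure rfl
  obtain ⟨x, hx, hxc, rfl⟩ := hmem
  obtain ⟨h, hh, ha, hc⟩ := hH
  obtain ⟨t, ht⟩ := hdvd h hh hc
  exact ⟨x, hx, (Int.odd_mul.1 (ht ▸ ha)).1, hxc, hdvd⟩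

lemma exists_dvd_b (H : Subgroup TwistedTriple) (hH : ∃ h ∈ H, Odd h.b ∧ Even h.a) :
    ∃ x ∈ H, Odd x.b ∧ Even x.a ∧ ∀ h ∈ H, Even h.a → x.b ∣ h.b := by
  obtain ⟨_, ⟨x, hx, rfl⟩, h1, h2, h3⟩ := exists_dvd_a (H.map rotate.toMonoidHom)
    (by obtain ⟨h, hh, h1, h2⟩ := hH; exact ⟨_, ⟨h, hh, rfl⟩, h1, h2⟩)
  exact ⟨x, hx, h1, h2, fun h hh => h3 _ ⟨h, hh, rfl⟩⟩

lemma exists_dvd_c (H : Subgroup TwistedTriple) (hH : ∃ h ∈ H, Odd h.c ∧ Even h.b) :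
    ∃ x ∈ H, Odd x.c ∧ Even x.b ∧ ∀ h ∈ H, Even h.b → x.c ∣ h.c := by
  obtain ⟨_, ⟨x, hx, rfl⟩, h1, h2, h3⟩ := exists_dvd_b (H.map rotate.toMonoidHom)
    (by obtain ⟨h, hh, h1, h2⟩ := hH; exact ⟨_, ⟨h, hh, rfl⟩, h1, h2⟩)
  exact ⟨x, hx, h1, h2, fun h hh => h3 _ ⟨h, hh, rfl⟩⟩

lemma exists_isHWPair {H : Subgroup TwistedTriple} (hE : H ≤ evenSum)
    (hx : ∃ h ∈ H, Odd h.a ∧ Even h.c) (hy : ∃ h ∈ H, Odd h.b ∧ Even h.a) :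
    ∃ x ∈ H, ∃ y ∈ H, IsHWPair x y ∧ (∀ h ∈ H, Even h.c → x.a ∣ h.a) ∧
      (∀ h ∈ H, Even h.a → y.b ∣ h.b) ∧ ∀ h ∈ H, Even h.b → (x * y).c ∣ h.c := by
  obtain ⟨x, hx, hxa, hxc, hxd⟩ := exists_dvd_a H hx
  obtain ⟨y, hy, hyb, hya, hyd⟩ := exists_dvd_b H hy
  have hxb : Odd x.b := by
    have := mem_evenSum.1 (hE hx)
    grind
  have hyc : Odd y.c := by
    have := mem_evenSum.1 (hE hy)
    grind
  have hxy : IsHWPair x y := ⟨hxa, hxb, hxc, hya, hyb, hyc⟩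
  obtain ⟨z, hz, hzc, hzb, hzd⟩ := exists_dvd_c H
    ⟨x * y, mul_mem hx hy, hxy.mul_c_odd, hxy.mul_b_even⟩
  have hza : Odd z.a := by
    have := mem_evenSum.1 (hE hz)
    grind
  obtain ⟨t, ht⟩ := hzd _ (mul_mem hx hy) hxy.mul_b_even
  have ht' : Odd t := by
    have := hxy.mul_c_odd
    rw [ht] at this
    exact (Int.odd_mul.1 this).2
  obtain ⟨k, rfl⟩ := ht'
  obtain ⟨w, hw_mem, hw⟩ : ∃ w ∈ H, w = ⟨2 * (k * 0), 2 * (k * 0), 2 * (k * z.c)⟩ :=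
    ⟨(z ^ (2 : ℤ)) ^ k, H.zpow_mem (H.zpow_mem hz _) _, by
      rw [sq_of_odd_a_c hza hzb hzc, translation_zpow]⟩
  have ha : (x * w).a = x.a := by simp [hw]
  have hb : (x * w).b = x.b := by simp [hw]
  have hc : (x * w).c = x.c - 2 * (k * z.c) := by
    simp [hw, paritySign_odd hxb, sub_eq_add_neg]
  refine ⟨x * w, mul_mem hx hw_mem, y, hy,
    ⟨ha ▸ hxa, hb ▸ hxb, ?_, hya, hyb, hyc⟩, by rwa [ha], hyd, ?_⟩
  · rw [hc]
    exact hxc.sub (even_two_mul _)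
  · have : (x * w * y).c = z.c := by
      rw [mul_c] at ht
      rw [mul_c, hb, hc]
      linear_combination ht
    rwa [this]

lemma nonempty_hw_mulEquiv {H : Subgroup TwistedTriple} (hE : H ≤ evenSum)
    (hx : ∃ h ∈ H, Odd h.a ∧ Even h.c) (hy : ∃ h ∈ H, Odd h.b ∧ Even h.a) :
    Nonempty (H ≃* HW) := by
  obtain ⟨x, hx, y, hy, hxy, hxd, hyd, hzd⟩ := exists_isHWPair hE hx hy
  have hx_range : x ∈ hxy.hom.range := ⟨hwx, hxy.hom_hwx⟩
  have hy_range : y ∈ hxy.hom.range := ⟨hwy, hxy.hom_hwy⟩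
  have hle := hxy.range_hom_le hx hy
  have heven : ∀ g ∈ H, Even g.a → Even g.b → Even g.c → g ∈ hxy.hom.range := by
    rintro ⟨a, b, c⟩ hg ha hb hc
    obtain ⟨i, hi⟩ := hxd _ hg hc
    obtain ⟨j, hj⟩ := hyd _ hg ha
    obtain ⟨k, hk⟩ := hzd _ hg hb
    dsimp only at *
    rw [hi, Int.even_mul, or_iff_right (Int.not_even_iff_odd.2 hxy.x_a)] at ha
    rw [hj, Int.even_mul, or_iff_right (Int.not_even_iff_odd.2 hxy.y_b)] at hb
    rw [hk, Int.even_mul, or_iff_right (Int.not_even_iff_odd.2 hxy.mul_c_odd)] at hc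
    obtain ⟨i, rfl⟩ := ha
    obtain ⟨j, rfl⟩ := hb
    obtain ⟨k, rfl⟩ := hc
    convert hxy.mk_mem_range_hom i j k using 2
    · rw [hi]; ring
    · rw [hj]; ring
    · rw [hk]; ring
  have hmul : ∀ u ∈ hxy.hom.range, ∀ g ∈ H, (Even g.a ↔ Even u.a) → (Even g.b ↔ Even u.b) →
      (Even g.c ↔ Even u.c) → g ∈ hxy.hom.range := by
    intro u hu g hg ha hb hc
    rw [← Subgroup.mul_mem_cancel_left _ (inv_mem hu)]
    apply heven _ (mul_mem (inv_mem (hle hu)) hg) <;>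
    simp only [mul_a, mul_b, mul_c, inv_a, inv_b, inv_c, Int.even_add, even_neg,
      even_paritySign_mul, ha, hb, hc]
  have hrange : hxy.hom.range = H := by
    refine le_antisymm hle fun g hg => ?_
    have hsum := mem_evenSum.1 (hE hg)
    have h1 := hxy.x_a
    have h2 := hxy.x_b
    have h3 := hxy.x_c
    have h4 := hxy.y_a
    have h5 := hxy.y_b
    have h6 := hxy.y_c
    have h7 := hxy.mul_a_odd
    have h8 := hxy.mul_b_even
    have h9 := hxy.mul_c_odd
    rcases Int.even_or_odd g.a with ha | ha <;> rcases Int.even_or_odd g.b with hb | hb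
    · exact heven g hg ha hb (by grind)
    · exact hmul y hy_range g hg (by grind) (by grind) (by grind)
    · exact hmul _ (mul_mem hx_range hy_range) g hg (by grind) (by grind) (by grind)
    · exact hmul x hx_range g hg (by grind) (by grind) (by grind)
  exact ⟨((MonoidHom.ofInjective hxy.hom_injective).trans
    (MulEquiv.subgroupCongr hrange)).symm⟩

end TwistedTriple

namespace TwistedTriple

/-- The lattice of translations in a subgroup. -/
def translationLattice (H : Subgroup TwistedTriple) : Submodule ℤ (ℤ × ℤ × ℤ) where
  carrier := {v | translation (.ofAdd v) ∈ H}
  zero_mem' := by simp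
  add_mem' {v w} hv hw := by
    simp only [Set.mem_ofPred_eq, ofAdd_add, map_mul] at *
    exact mul_mem hv hw
  smul_mem' n v hv := by
    simp only [Set.mem_ofPred_eq, ofAdd_zsmul, map_zpow] at *
    exact zpow_mem hv n

lemma mem_translationLattice {H : Subgroup TwistedTriple} {v : ℤ × ℤ × ℤ} :
    v ∈ translationLattice H ↔ translation (.ofAdd v) ∈ H := Iff.rfl

lemma nonempty_lattice_mulEquiv {H : Subgroup TwistedTriple}
    (heven : ∀ h ∈ H, Even h.a ∧ Even h.b ∧ Even h.c) {m : ℤ} (hm : m ≠ 0)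
    (hH : ∀ v, m • v ∈ translationLattice H) :
    Nonempty (H ≃* Multiplicative (ℤ × ℤ × ℤ)) := by
  obtain ⟨e⟩ := nonempty_linearEquiv_of_smul_mem _ hm hH
  let f : Multiplicative (ℤ × ℤ × ℤ) →* TwistedTriple :=
    translation.comp
      ((translationLattice H).subtype.comp e.toLinearMap).toAddMonoidHom.toMultiplicative
  have hf : Function.Injective f :=
    translation_injective.comp (Subtype.val_injective.comp e.injective)
  have hrange : f.range = H := by
    ext g
    refine ⟨?_, fun hg => ?_⟩
    · rintro ⟨v, rfl⟩
      exact (e v.toAdd).2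
    · obtain ⟨⟨p, hp⟩, ⟨q, hq⟩, ⟨r, hr⟩⟩ := heven g hg
      have hg' : translation (.ofAdd (p, q, r)) = g := by
        ext <;> simp only [translation_ofAdd, hp, hq, hr, two_mul]
      refine ⟨.ofAdd (e.symm ⟨(p, q, r), mem_translationLattice.2 (hg' ▸ hg)⟩), ?_⟩
      change translation (.ofAdd (e (e.symm _)).1) = g
      rw [e.apply_symm_apply]
      exact hg'
  exact ⟨((MonoidHom.ofInjective hf).trans (MulEquiv.subgroupCongr hrange)).symm⟩

lemma nonempty_g2_mulEquiv {H : Subgroup TwistedTriple} (hE : H ≤ evenSum)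
    (hc : ∀ h ∈ H, Even h.c) (ha : ∃ h ∈ H, Odd h.a) {m : ℤ} (hm : m ≠ 0)
    (hH : ∀ v, m • v ∈ translationLattice H) : Nonempty (H ≃* G2) := by
  obtain ⟨z, hz, hza, hzc, hzd⟩ := exists_dvd_a H (by
    obtain ⟨h, hh, h1⟩ := ha
    exact ⟨h, hh, h1, hc h hh⟩)
  have hzb : Odd z.b := by
    have := mem_evenSum.1 (hE hz)
    grind
  obtain ⟨e⟩ := nonempty_linearEquiv_of_smul_mem
    ((translationLattice H).comap (LinearMap.inr ℤ ℤ (ℤ × ℤ))) hm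
    (fun v => by
      rw [Submodule.mem_comap, map_smul]
      exact hH _)
  let t : Multiplicative (ℤ × ℤ) →* TwistedTriple := translation.comp
    ((LinearMap.inr ℤ ℤ (ℤ × ℤ)).comp ((Submodule.subtype _).comp
      e.toLinearMap)).toAddMonoidHom.toMultiplicative
  have ht (v : ℤ × ℤ) : t (.ofAdd v) = ⟨2 * 0, 2 * (e v).1.1, 2 * (e v).1.2⟩ := rfl
  have ht_mem (v : ℤ × ℤ) : t (.ofAdd v) ∈ H := (e v).2
  have ht_inj : Function.Injective t := translation_injective.comp
    (LinearMap.inr_injective.comp (Subtype.val_injective.comp e.injective))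
  have ht_rel (v : ℤ × ℤ) : z * t (.ofAdd v) * z⁻¹ * t (.ofAdd v) = 1 := by
    rw [ht]
    have hs := paritySign_odd (hzb.add_even (even_two_mul (e v).1.1).neg)
    have hs' := paritySign_even (hzc.add (even_two_mul (e v).1.2).neg)
    ext <;> simp [paritySign_even, paritySign_odd, hza, hzb, hzc, hs, hs']
  let f : G2 →* TwistedTriple := g2Lift (t (.ofAdd (1, 0))) (t (.ofAdd (0, 1))) z
    (by rw [mul_inv_eq_one, mul_inv_eq_iff_eq_mul, ← map_mul t, ← map_mul t, mul_comm])
    (ht_rel _) (ht_rel _)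
  have hf (i j k : ℤ) : f (PresentedGroup.of 0 ^ i * PresentedGroup.of 1 ^ j *
      PresentedGroup.of 2 ^ k) = t (.ofAdd (i, j)) * z ^ k := by
    simp only [f, map_mul, map_zpow, g2Lift_of, Matrix.cons_val]
    rw [← map_zpow t, ← map_zpow t, ← map_mul t, ← ofAdd_zsmul, ← ofAdd_zsmul, ← ofAdd_add]
    simp
  have hz_ne : z.a ≠ 0 := fun h0 => by simp [h0] at hza
  have hf_inj : Function.Injective f := by
    rw [injective_iff_map_eq_one]
    intro g hg
    obtain ⟨i, j, k, rfl⟩ := exists_eq_g2 g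
    rw [hf] at hg
    have hk : k = 0 := by
      have := congrArg TwistedTriple.a hg
      rw [mul_a, ht, (zpow_a_of_even_c hzc k).1] at this
      simpa [paritySign_even, hz_ne] using this
    subst hk
    rw [zpow_zero, mul_one, ← map_one t, ht_inj.eq_iff, ofAdd_eq_one, Prod.mk_eq_zero] at hg
    simp [hg.1, hg.2]
  have hrange : f.range = H := by
    ext g
    refine ⟨?_, fun hg => ?_⟩
    · rintro ⟨g, rfl⟩
      obtain ⟨i, j, k, rfl⟩ := exists_eq_g2 g
      rw [hf]
      exact mul_mem (ht_mem _) (zpow_mem hz _)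
    · obtain ⟨k, hk⟩ := hzd g hg (hc g hg)
      have hu : g * z ^ (-k) ∈ H := mul_mem hg (zpow_mem hz _)
      have hua : (g * z ^ (-k)).a = 0 := by
        rw [mul_a, (zpow_a_of_even_c hzc _).1, paritySign_even (hc g hg), hk]
        ring
      have hsum := mem_evenSum.1 (hE hu)
      obtain ⟨r, hr⟩ := hc _ hu
      obtain ⟨q, hq⟩ : Even (g * z ^ (-k)).b := by grind
      have hu' : translation (.ofAdd (0, q, r)) = g * z ^ (-k) := by
        rw [translation_ofAdd]
        ext
        · simp only [hua, mul_zero]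
        · simp only [hq, two_mul]
        · simp only [hr, two_mul]
      obtain ⟨⟨i, j⟩, hij⟩ := e.surjective ⟨(q, r), mem_translationLattice.2 (hu' ▸ hu)⟩
      refine ⟨_, (hf i j k).trans ?_⟩
      rw [← eq_mul_inv_iff_mul_eq, ← zpow_neg, ← hu', ht, hij]
      rfl
  exact ⟨((MonoidHom.ofInjective hf_inj).trans (MulEquiv.subgroupCongr hrange)).symm⟩

end TwistedTriple

namespace TwistedTriple

lemma isHWPair_standard : IsHWPair ⟨1, 1, 0⟩ ⟨0, 1, 1⟩ := by
  constructor <;> decide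

/-- The embedding of the Hantzsche–Wendt group into the twisted triples. -/
def hwHom : HW →* TwistedTriple := isHWPair_standard.hom

lemma hwHom_injective : Function.Injective hwHom := isHWPair_standard.hom_injective

lemma range_hwHom_le : hwHom.range ≤ evenSum :=
  isHWPair_standard.range_hom_le (mem_evenSum.2 (by decide)) (mem_evenSum.2 (by decide))

lemma translation_mem_range_hwHom (v : Multiplicative (ℤ × ℤ × ℤ)) :
    translation v ∈ hwHom.range := by
  have h := isHWPair_standard.mk_mem_range_hom v.toAdd.1 v.toAdd.2.1 (-v.toAdd.2.2)
  have hc : ((⟨1, 1, 0⟩ : TwistedTriple) * ⟨0, 1, 1⟩).c = -1 := by decide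
  simp only [hc, mul_one, mul_neg, neg_neg] at h
  exact h

lemma ker_parity_comp_hwHom :
    (parity.comp hwHom).ker = Subgroup.normalClosure {hwx ^ 2, hwy ^ 2, hwz ^ 2} := by
  apply le_antisymm
  · intro g hg
    obtain ⟨i, j, k, rfl⟩ := exists_eq_hw g
    obtain ⟨hi, hj⟩ := isHWPair_standard.even_of_parity_eq_one (i := i) (j := j) (k := k) (by
      rw [← MonoidHom.mem_ker.1 hg]
      simp only [MonoidHom.comp_apply, hwHom, map_mul, map_zpow, IsHWPair.hom_hwx,
        IsHWPair.hom_hwy])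
    obtain ⟨i, rfl⟩ := even_iff_two_dvd.1 hi
    obtain ⟨j, rfl⟩ := even_iff_two_dvd.1 hj
    have hx : hwx ^ 2 ∈ Subgroup.normalClosure {hwx ^ 2, hwy ^ 2, hwz ^ 2} :=
      Subgroup.subset_normalClosure (by simp)
    have hy : hwy ^ 2 ∈ Subgroup.normalClosure {hwx ^ 2, hwy ^ 2, hwz ^ 2} :=
      Subgroup.subset_normalClosure (by simp)
    have hz : hwz ^ 2 ∈ Subgroup.normalClosure {hwx ^ 2, hwy ^ 2, hwz ^ 2} :=
      Subgroup.subset_normalClosure (by simp)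
    have hxy : (hwx * hwy) ^ 2 = (hwz ^ 2)⁻¹ := by rw [hwz_eq, inv_pow, inv_inv]
    rw [← inv_mem_iff, ← hxy] at hz
    rw [zpow_mul, zpow_mul]
    exact mul_mem (mul_mem (zpow_mem (by exact_mod_cast hx) _) (zpow_mem (by exact_mod_cast hy) _))
      (zpow_mem (by exact_mod_cast hz) _)
  · apply Subgroup.normalClosure_le_normal
    have hsq (g : HW) : (parity.comp hwHom) (g ^ 2) = 1 := by
      rw [map_pow]
      generalize (parity.comp hwHom) g = u
      revert u
      decide
    rintro _ (rfl | rfl | rfl) <;> exact hsq _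

lemma parity_eq {g : TwistedTriple} {p q : ZMod 2} (h : parity g = .ofAdd (p, q)) :
    (g.a : ZMod 2) = p ∧ (g.b : ZMod 2) = q :=
  ⟨congrArg (fun u => u.toAdd.1) h, congrArg (fun u => u.toAdd.2) h⟩

lemma nonempty_lattice_of_card {H : Subgroup TwistedTriple} (hE : H ≤ evenSum) {m : ℤ}
    (hm : m ≠ 0) (hH : ∀ v, m • v ∈ translationLattice H) (hcard : Nat.card (H.map parity) = 1) :
    Nonempty (H ≃* Multiplicative (ℤ × ℤ × ℤ)) := by
  refine nonempty_lattice_mulEquiv (fun h hh => ?_) hm hH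
  rw [Subgroup.card_eq_one, Subgroup.map_eq_bot_iff] at hcard
  have h1 := parity_eq_one_iff.1 (hcard hh)
  have h2 := mem_evenSum.1 (hE hh)
  grind

lemma nonempty_hw_of_card {H : Subgroup TwistedTriple} (hE : H ≤ evenSum)
    (hcard : Nat.card (H.map parity) = 4) : Nonempty (H ≃* HW) := by
  have htop : H.map parity = ⊤ := Subgroup.eq_top_of_card_eq _ (by
    rw [hcard, Nat.card_eq_fintype_card]; rfl)
  have key (p q : ZMod 2) : ∃ h ∈ H, parity h = .ofAdd (p, q) := by
    have : (.ofAdd (p, q) : Multiplicative (ZMod 2 × ZMod 2)) ∈ H.map parity := htop ▸ trivial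
    exact this
  obtain ⟨x, hx, hxp⟩ := key 1 1
  obtain ⟨y, hy, hyp⟩ := key 0 1
  have hxp := parity_eq hxp
  have hyp := parity_eq hyp
  rw [ZMod.intCast_eq_one_iff_odd, ZMod.intCast_eq_one_iff_odd] at hxp
  rw [ZMod.intCast_eq_zero_iff_even, ZMod.intCast_eq_one_iff_odd] at hyp
  have hsum := mem_evenSum.1 (hE hx)
  exact nonempty_hw_mulEquiv hE ⟨x, hx, hxp.1, by grind⟩ ⟨y, hy, hyp.2, hyp.1⟩

lemma map_rotate_le_evenSum_and_smul_mem {H : Subgroup TwistedTriple} {m : ℤ}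
    (hE : H ≤ evenSum) (hH : ∀ v, m • v ∈ translationLattice H) :
    H.map rotate.toMonoidHom ≤ evenSum ∧
      ∀ v, m • v ∈ translationLattice (H.map rotate.toMonoidHom) := by
  refine ⟨?_, fun v => ⟨_, hH (v.2.2, v.1, v.2.1), rfl⟩⟩
  rintro _ ⟨h, hh, rfl⟩
  have := mem_evenSum.1 (hE hh)
  rw [mem_evenSum]
  change Even (h.b + h.c + h.a)
  rwa [show h.b + h.c + h.a = h.a + h.b + h.c by ring]

lemma nonempty_g2_of_card {H : Subgroup TwistedTriple} (hE : H ≤ evenSum) {m : ℤ}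
    (hm : m ≠ 0) (hH : ∀ v, m • v ∈ translationLattice H) (hcard : Nat.card (H.map parity) = 2) :
    Nonempty (H ≃* G2) := by
  obtain ⟨⟨_, ⟨t, ht, rfl⟩⟩, ht1, htu⟩ := (Nat.card_eq_two_iff' (1 : H.map parity)).1 hcard
  have hdich (h) (hh : h ∈ H) : parity h = 1 ∨ parity h = parity t := by
    by_cases h1 : parity h = 1
    · exact .inl h1
    · exact .inr (congrArg Subtype.val
        (htu ⟨parity h, h, hh, rfl⟩ fun h2 => h1 (congrArg Subtype.val h2)))
  have ht1 : ¬(Even t.a ∧ Even t.b) := fun h =>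
    ht1 (Subtype.ext (parity_eq_one_iff.2 h))
  have hpar (h) (hh : h ∈ H) : (Even h.a ∧ Even h.b ∧ Even h.c) ∨
      ((Even h.a ↔ Even t.a) ∧ (Even h.b ↔ Even t.b) ∧ (Even h.c ↔ Even t.c)) := by
    have h2 := mem_evenSum.1 (hE hh)
    have h3 := mem_evenSum.1 (hE ht)
    rcases hdich h hh with h1 | h1
    · rw [parity_eq_one_iff] at h1
      grind
    · obtain ⟨h4, h5⟩ := parity_eq h1
      rw [← sub_eq_zero, ← Int.cast_sub, ZMod.intCast_eq_zero_iff_even, Int.even_sub] at h4 h5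
      grind
  have htsum := mem_evenSum.1 (hE ht)
  obtain ⟨hE', hH'⟩ := map_rotate_le_evenSum_and_smul_mem hE hH
  obtain ⟨hE'', hH''⟩ := map_rotate_le_evenSum_and_smul_mem hE' hH'
  rcases Int.even_or_odd t.a with ha | ha
  · obtain ⟨e⟩ := nonempty_g2_mulEquiv hE' (by
      rintro _ ⟨h, hh, rfl⟩
      change Even h.a
      have := hpar h hh
      grind) ⟨_, ⟨t, ht, rfl⟩, by
        change Odd t.b
        grind⟩ hm hH'
    exact ⟨(H.equivMapOfInjective _ rotate.injective).trans e⟩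
  · rcases Int.even_or_odd t.b with hb | hb
    · obtain ⟨e⟩ := nonempty_g2_mulEquiv hE'' (by
        rintro _ ⟨_, ⟨h, hh, rfl⟩, rfl⟩
        change Even h.b
        have := hpar h hh
        grind) ⟨_, ⟨_, ⟨t, ht, rfl⟩, rfl⟩, by
          change Odd t.c
          grind⟩ hm hH''
      exact ⟨((H.equivMapOfInjective _ rotate.injective).trans
        (Subgroup.equivMapOfInjective _ _ rotate.injective)).trans e⟩
    · exact nonempty_g2_mulEquiv hE (fun h hh => by
        have := hpar h hh
        grind) ⟨t, ht, ha⟩ hm hH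

end TwistedTriple

open TwistedTriple

lemma hw_hom_int_eq_one (f : HW →* Multiplicative ℤ) : f = 1 := by
  have hy : f hwy = 1 := by
    have := congrArg f hwx_mul_hwy_sq
    simp only [map_mul, map_pow, map_inv, map_one] at this
    have := congrArg Multiplicative.toAdd this
    refine Multiplicative.toAdd.injective ?_
    simp at this ⊢
    omega
  have hx : f hwx = 1 := by
    have := congrArg f hwy_mul_hwx_sq
    simp only [map_mul, map_pow, map_inv, map_one] at this
    have := congrArg Multiplicative.toAdd this
    refine Multiplicative.toAdd.injective ?_
    simp at this ⊢
    omega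
  refine MonoidHom.ext fun g => ?_
  obtain ⟨i, j, k, rfl⟩ := exists_eq_hw g
  simp [hx, hy]

lemma exists_g2_hom_int_ne_one : ∃ f : G2 →* Multiplicative ℤ, f ≠ 1 := by
  refine ⟨g2Lift 1 1 (.ofAdd 1) (by simp) (by simp) (by simp), fun h => ?_⟩
  have := DFunLike.congr_fun h (PresentedGroup.of 2)
  rw [g2Lift_of] at this
  exact absurd this (by decide)

lemma exists_g2_not_commute : ∃ g h : G2, g * h ≠ h * g := by
  refine ⟨PresentedGroup.of 0, PresentedGroup.of 2, fun h => ?_⟩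
  have := congrArg (g2Lift (G := DihedralGroup 3) (.r 1) (.r 1) (.sr 0)
    (by decide) (by decide) (by decide)) h
  rw [map_mul, map_mul, g2Lift_of, g2Lift_of] at this
  exact absurd this (by decide)

lemma isEmpty_hw_mulEquiv_lattice : IsEmpty (HW ≃* Multiplicative (ℤ × ℤ × ℤ)) := by
  refine ⟨fun e => ?_⟩
  have h := DFunLike.congr_fun
    (hw_hom_int_eq_one ((AddMonoidHom.fst ℤ (ℤ × ℤ)).toMultiplicative.comp e.toMonoidHom))
    (e.symm (.ofAdd (1, 0)))
  simp at h

lemma isEmpty_g2_mulEquiv_lattice : IsEmpty (G2 ≃* Multiplicative (ℤ × ℤ × ℤ)) := by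
  refine ⟨fun e => ?_⟩
  obtain ⟨g, h, hgh⟩ := exists_g2_not_commute
  exact hgh (e.injective (by rw [map_mul, map_mul, mul_comm]))

lemma isEmpty_g2_mulEquiv_hw : IsEmpty (G2 ≃* HW) := by
  refine ⟨fun e => ?_⟩
  obtain ⟨f, hf⟩ := exists_g2_hom_int_ne_one
  refine hf (MonoidHom.ext fun g => ?_)
  simpa using DFunLike.congr_fun (hw_hom_int_eq_one (f.comp e.symm.toMonoidHom)) (e g)

lemma card_map_mk_eq (H : Subgroup HW) :
    Nat.card (H.map (QuotientGroup.mk'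
      (Subgroup.normalClosure {hwx ^ 2, hwy ^ 2, hwz ^ 2}))) =
      Nat.card ((H.map hwHom).map parity) := by
  rw [Subgroup.map_map, ← Subgroup.relIndex_ker, ← Subgroup.relIndex_ker, QuotientGroup.ker_mk',
    ker_parity_comp_hwHom]

lemma exists_smul_mem_translationLattice {H : Subgroup HW} (hH : H.index ≠ 0) :
    ∃ m : ℤ, m ≠ 0 ∧ ∀ v, m • v ∈ translationLattice (H.map hwHom) := by
  refine ⟨(H.index.factorial : ℕ), by exact_mod_cast H.index.factorial_ne_zero, fun v => ?_⟩
  obtain ⟨g, hg⟩ := translation_mem_range_hwHom (.ofAdd v)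
  rw [mem_translationLattice, ofAdd_zsmul, map_zpow, ← hg, zpow_natCast, ← map_pow]
  exact ⟨_, H.pow_mem_of_index_ne_zero_of_dvd hH g fun _ => Nat.dvd_factorial, rfl⟩

theorem stmt16 (H : Subgroup HW) (hH : H.index ≠ 0) :
    (Nonempty (H ≃* Multiplicative (ℤ × ℤ × ℤ)) ↔
        Nat.card (H.map (QuotientGroup.mk'
          (Subgroup.normalClosure {hwx ^ 2, hwy ^ 2, hwz ^ 2}))) = 1) ∧
      (Nonempty (H ≃* G2) ↔
        Nat.card (H.map (QuotientGroup.mk'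
          (Subgroup.normalClosure {hwx ^ 2, hwy ^ 2, hwz ^ 2}))) = 2) ∧
      (Nonempty (H ≃* HW) ↔
        Nat.card (H.map (QuotientGroup.mk'
          (Subgroup.normalClosure {hwx ^ 2, hwy ^ 2, hwz ^ 2}))) = 4) ∧
      (Nonempty (H ≃* Multiplicative (ℤ × ℤ × ℤ)) ∨ Nonempty (H ≃* G2) ∨
        Nonempty (H ≃* HW)) := by
  rw [card_map_mk_eq]
  have hE : H.map hwHom ≤ evenSum :=
    (H.map_le_range hwHom).trans range_hwHom_le
  obtain ⟨m, hm, hlat⟩ := exists_smul_mem_translationLattice hH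
  have e := H.equivMapOfInjective hwHom hwHom_injective
  have hdvd : Nat.card ((H.map hwHom).map parity) ∣ 4 := by
    simpa [Nat.card_eq_fintype_card] using
      Subgroup.card_subgroup_dvd_card ((H.map hwHom).map parity)
  have h1 (h : Nat.card ((H.map hwHom).map parity) = 1) :
      Nonempty (H ≃* Multiplicative (ℤ × ℤ × ℤ)) :=
    (nonempty_lattice_of_card hE hm hlat h).map e.trans
  have h2 (h : Nat.card ((H.map hwHom).map parity) = 2) : Nonempty (H ≃* G2) :=
    (nonempty_g2_of_card hE hm hlat h).map e.trans
  have h4 (h : Nat.card ((H.map hwHom).map parity) = 4) : Nonempty (H ≃* HW) :=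
    (nonempty_hw_of_card hE h).map e.trans
  have n12 : Nonempty (H ≃* Multiplicative (ℤ × ℤ × ℤ)) → Nonempty (H ≃* G2) → False :=
    fun ⟨f⟩ ⟨g⟩ => isEmpty_g2_mulEquiv_lattice.false (g.symm.trans f)
  have n14 : Nonempty (H ≃* Multiplicative (ℤ × ℤ × ℤ)) → Nonempty (H ≃* HW) → False :=
    fun ⟨f⟩ ⟨g⟩ => isEmpty_hw_mulEquiv_lattice.false (g.symm.trans f)
  have n24 : Nonempty (H ≃* G2) → Nonempty (H ≃* HW) → False :=
    fun ⟨f⟩ ⟨g⟩ => isEmpty_g2_mulEquiv_hw.false (f.symm.trans g)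
  have hcases : Nat.card ((H.map hwHom).map parity) = 1 ∨
      Nat.card ((H.map hwHom).map parity) = 2 ∨ Nat.card ((H.map hwHom).map parity) = 4 := by
    have := Nat.le_of_dvd (by norm_num) hdvd
    interval_cases Nat.card ((H.map hwHom).map parity) <;> omega
  rcases hcases with h | h | h
  · have := h1 h
    simp only [h]
    tauto
  · have := h2 h
    simp only [h]
    tauto
  · have := h4 h
    simp only [h]
    tauto
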